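/- Let F be a proper filter in S and let s, t ∈ F. Then there exists an idempotent e ∈ d(F) ∩ E such that s·e = t·e (so the germ of (s, d(F) ∩ E) does not depend on the choice of s ∈ F). -/

import Mathlib

/-- An inverse semigroup with zero: every element `a` has a unique `a⁻¹` with
`a * a⁻¹ * a = a` and `a⁻¹ * a * a⁻¹ = a⁻¹`, and `0` is absorbing. -/
class InvSemigroupWithZero (S : Type*) extends Semigroup S, Zero S, Inv S where
  mul_inv_mul : ∀ a : S, a * a⁻¹ * a = a
  inv_mul_inv : ∀ a : S, a⁻¹ * a * a⁻¹ = a⁻¹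
  inv_unique : ∀ a b : S, a * b * a = a → b * a * b = b → b = a⁻¹
  zero_mul : ∀ a : S, 0 * a = 0
  mul_zero : ∀ a : S, a * 0 = 0

namespace InvSemigroupWithZero

variable {S : Type*} [InvSemigroupWithZero S]

/-- The natural partial order on `S`: `a ≤ b` iff `a = a * a⁻¹ * b`. -/
def sle (a b : S) : Prop := a = a * a⁻¹ * b

/-- `↓s`, the down-set of `s` w.r.t. the natural partial order. -/
def dwn (s : S) : Set S := {t : S | sle t s}

/-- `↑A`, the up-set generated by `A` w.r.t. the natural partial order. -/
def up (A : Set S) : Set S := {b : S | ∃ a ∈ A, sle a b}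

/-- A filter in `S`: a nonempty down-directed up-set. -/
def IsFilt (F : Set S) : Prop :=
  F.Nonempty ∧ up F = F ∧ ∀ a ∈ F, ∀ b ∈ F, ∃ c ∈ F, sle c a ∧ sle c b

/-- A proper filter: a filter not containing `0`. -/
def IsPFilt (F : Set S) : Prop := IsFilt F ∧ (0 : S) ∉ F

/-- An ultrafilter: a proper filter maximal among proper filters. -/
def IsUltra (U : Set S) : Prop :=
  IsPFilt U ∧ ∀ G : Set S, IsPFilt G → U ⊆ G → U = G

/-- The set `E` of idempotents of `S`. -/
def E (S : Type*) [InvSemigroupWithZero S] : Set S := {e : S | e * e = e}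

/-- `F⁻¹ = {a⁻¹ : a ∈ F}`. -/
def finv (F : Set S) : Set S := (fun a : S => a⁻¹) '' F

/-- `F · G = ↑{fg : f ∈ F, g ∈ G}`. -/
def fmul (F G : Set S) : Set S := up (Set.image2 (· * ·) F G)

/-- The source `d(F) := F⁻¹ · F`. -/
def src (F : Set S) : Set S := fmul (finv F) F

/-- The range `r(F) := F · F⁻¹`. -/
def rng (F : Set S) : Set S := fmul F (finv F)

/-- The natural partial order on the idempotents: `e ≤ f` iff `e = e * f`. -/
def ele (e f : S) : Prop := e = e * f

/-- The down-set of an idempotent `e` inside `E`. -/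
def edwn (e : S) : Set S := {f : S | f ∈ E S ∧ ele f e}

/-- The up-set generated by `A` inside `E`. -/
def eup (A : Set S) : Set S := {f : S | f ∈ E S ∧ ∃ a ∈ A, ele a f}

/-- An `E`-filter: a proper filter of the inverse semigroup `E` of idempotents. -/
def IsEFilt (ξ : Set S) : Prop :=
  ξ ⊆ E S ∧ ξ.Nonempty ∧ eup ξ = ξ ∧
    (∀ a ∈ ξ, ∀ b ∈ ξ, ∃ c ∈ ξ, ele c a ∧ ele c b) ∧ (0 : S) ∉ ξ

/-- An `E`-ultrafilter: an `E`-filter maximal among `E`-filters. -/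
def IsEUltra (ξ : Set S) : Prop :=
  IsEFilt ξ ∧ ∀ η : Set S, IsEFilt η → ξ ⊆ η → ξ = η

/-- `β_s(ξ) = {f ∈ E : s·e·s⁻¹ ≤ f for some e ∈ ξ}`. -/
def beta (s : S) (ξ : Set S) : Set S :=
  {f : S | f ∈ E S ∧ ∃ e ∈ ξ, sle (s * e * s⁻¹) f}

/-- The set of proper filters in `S`. -/
abbrev PFilt (S : Type*) [InvSemigroupWithZero S] := {F : Set S // IsPFilt F}

/-- The patch topology on the set of proper filters, generated by the sets
`F(s;T) = {F : s ∈ F, F ∩ T = ∅}` for `s ∈ S` and finite `T ⊆ ↓s`. -/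
instance patchTopology : TopologicalSpace (PFilt S) :=
  TopologicalSpace.generateFrom
    {O : Set (PFilt S) | ∃ (s : S) (T : Set S), T.Finite ∧ T ⊆ dwn s ∧
      O = {F : PFilt S | s ∈ F.1 ∧ F.1 ∩ T = ∅}}

/-- The set of idempotent proper filters in `S`. -/
abbrev IPFilt (S : Type*) [InvSemigroupWithZero S] :=
  {F : Set S // IsPFilt F ∧ (F ∩ E S).Nonempty}

/-- The subspace topology induced by the patch topology on proper filters. -/
instance : TopologicalSpace (IPFilt S) :=
  TopologicalSpace.induced (fun F => (⟨F.1, F.2.1⟩ : PFilt S)) inferInstance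

/-- The set of `E`-filters. -/
abbrev EFilt (S : Type*) [InvSemigroupWithZero S] := {ξ : Set S // IsEFilt ξ}

/-- The patch topology on the set of `E`-filters, generated by the sets
`P(e;X) = {ξ : e ∈ ξ, ξ ∩ X = ∅}` for `e ∈ E` and finite `X ⊆ ↓e ∩ E`. -/
instance : TopologicalSpace (EFilt S) :=
  TopologicalSpace.generateFrom
    {O : Set (EFilt S) | ∃ (e : S) (X : Set S), e ∈ E S ∧ X.Finite ∧ X ⊆ edwn e ∧
      O = {ξ : EFilt S | e ∈ ξ.1 ∧ ξ.1 ∩ X = ∅}}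

/-- The set of ultrafilters in `S`. -/
abbrev UFilt (S : Type*) [InvSemigroupWithZero S] := {U : Set S // IsUltra U}

/-- The subspace topology induced by the patch topology on proper filters. -/
instance : TopologicalSpace (UFilt S) :=
  TopologicalSpace.induced (fun U => (⟨U.1, U.2.1⟩ : PFilt S)) inferInstance

end InvSemigroupWithZero

open InvSemigroupWithZero

namespace InvSemigroupWithZero

variable {S : Type*} [InvSemigroupWithZero S]

theorem inv_eq_self_of_mul_self {e : S} (he : e * e = e) : e⁻¹ = e :=
  (inv_unique e e (by rw [he, he]) (by rw [he, he])).symm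

theorem mul_idempotent {e f : S} (he : e * e = e) (hf : f * f = f) :
    e * f * (e * f) = e * f := by
  have h₁ := mul_inv_mul (e * f)
  have h₂ := inv_mul_inv (e * f)
  have hx : f * (e * f)⁻¹ * e = (e * f)⁻¹ := by
    apply inv_unique
    · calc e * f * (f * (e * f)⁻¹ * e) * (e * f)
          = e * (f * f) * (e * f)⁻¹ * ((e * e) * f) := by simp only [mul_assoc]
        _ = e * f := by rw [he, hf, h₁]
    · calc f * (e * f)⁻¹ * e * (e * f) * (f * (e * f)⁻¹ * e)
          = f * ((e * f)⁻¹ * ((e * e) * (f * f)) * (e * f)⁻¹) * e := by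
            simp only [mul_assoc]
        _ = f * (e * f)⁻¹ * e := by rw [he, hf, h₂]
  have hxx : (e * f)⁻¹ * (e * f)⁻¹ = (e * f)⁻¹ := by
    calc (e * f)⁻¹ * (e * f)⁻¹
        = f * (e * f)⁻¹ * e * (f * (e * f)⁻¹ * e) := by rw [hx]
      _ = f * ((e * f)⁻¹ * (e * f) * (e * f)⁻¹) * e := by simp only [mul_assoc]
      _ = (e * f)⁻¹ := by rw [h₂, hx]
  have h : e * f = (e * f)⁻¹ :=
    (inv_unique _ _ h₂ h₁).trans (inv_eq_self_of_mul_self hxx)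
  rwa [← h] at hxx

theorem idempotents_commute {e f : S} (he : e * e = e) (hf : f * f = f) :
    e * f = f * e := by
  have hef := mul_idempotent he hf
  have hfe := mul_idempotent hf he
  refine (inv_eq_self_of_mul_self hef).symm.trans (inv_unique _ _ ?_ ?_).symm
  · calc e * f * (f * e) * (e * f)
        = e * (f * f) * ((e * e) * f) := by simp only [mul_assoc]
      _ = e * f := by rw [he, hf, hef]
  · calc f * e * (e * f) * (f * e)
        = f * (e * e) * ((f * f) * e) := by simp only [mul_assoc]
      _ = f * e := by rw [he, hf, hfe]

theorem mul_inv_idempotent (a : S) : a * a⁻¹ * (a * a⁻¹) = a * a⁻¹ := by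
  rw [← mul_assoc, mul_inv_mul]

theorem inv_mul_idempotent (a : S) : a⁻¹ * a * (a⁻¹ * a) = a⁻¹ * a := by
  rw [← mul_assoc, inv_mul_inv]

theorem sle_refl (a : S) : sle a a := (mul_inv_mul a).symm

theorem mul_inv_mul_of_sle {c s : S} (h : sle c s) : s * (c⁻¹ * c) = c := by
  have hf := mul_inv_idempotent c
  have hc : c * c⁻¹ * s = c := h.symm
  generalize c * c⁻¹ = f at hf hc
  have hcomm : s * s⁻¹ * f = f * (s * s⁻¹) := idempotents_commute (mul_inv_idempotent s) hf
  have hsc : s * (s⁻¹ * f * c) = c := by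
    calc s * (s⁻¹ * f * c) = s * s⁻¹ * f * c := by simp only [mul_assoc]
      _ = f * (s * s⁻¹) * (f * s) := by rw [hcomm, hc]
      _ = f * (s * s⁻¹ * f) * s := by simp only [mul_assoc]
      _ = (f * f) * (s * s⁻¹ * s) := by rw [hcomm]; simp only [mul_assoc]
      _ = c := by rw [hf, mul_inv_mul, hc]
  have hfc : f * c = c := by rw [← hc, ← mul_assoc, hf]
  have hinv : s⁻¹ * f = c⁻¹ := by
    apply inv_unique
    · calc c * (s⁻¹ * f) * c = f * (s * (s⁻¹ * f * c)) := by
            nth_rewrite 1 [← hc]; simp only [mul_assoc]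
        _ = c := by rw [hsc, hfc]
    · calc s⁻¹ * f * c * (s⁻¹ * f) = s⁻¹ * (f * c) * (s⁻¹ * f) := by simp only [mul_assoc]
        _ = s⁻¹ * (f * s) * (s⁻¹ * f) := by rw [hfc, hc]
        _ = s⁻¹ * (f * (s * s⁻¹)) * f := by simp only [mul_assoc]
        _ = s⁻¹ * s * s⁻¹ * (f * f) := by rw [← hcomm]; simp only [mul_assoc]
        _ = s⁻¹ * f := by rw [inv_mul_inv, hf]
  rw [← hinv, hsc]

end InvSemigroupWithZero

/-- If `F` is a proper filter and `s, t ∈ F`, then there is an idempotent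
`e ∈ d(F) ∩ E` with `s·e = t·e`. -/
theorem stmt_12 {S : Type*} [InvSemigroupWithZero S]
    (F : Set S) (hF : IsPFilt F) (s t : S) (hs : s ∈ F) (ht : t ∈ F) :
    ∃ e ∈ src F ∩ E S, s * e = t * e := by
  obtain ⟨c, hc, hcs, hct⟩ := hF.1.2.2 s hs t ht
  refine ⟨c⁻¹ * c, ⟨⟨c⁻¹ * c, ⟨c⁻¹, ⟨c, hc, rfl⟩, c, hc, rfl⟩, sle_refl _⟩,
    inv_mul_idempotent c⟩, ?_⟩
  rw [mul_inv_mul_of_sle hcs, mul_inv_mul_of_sle hct]
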